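/- The degree-1 component of Λ_n is a free ℤ-module of rank (n-1)(n-2)(n-3)/6, isomorphic as an S_n-module to ∧³𝔥_n, where 𝔥_n is the sublattice of ℤⁿ of vectors with coordinate sum 0; the isomorphism sends ω_{ijkl} to (e_i - e_l) ∧ (e_j - e_l) ∧ (e_k - e_l). -/

import Mathlib

open Finset

/-- Linear relations among the generators `ω_{ijkl}` of `Λ_n`: antisymmetry, vanishing for
repeated indices, and the 5-term relation. (The quadratic relations of `Λ_n` do not affect
degree 1, so this presents the degree-1 component `Λ_n[1]`.) -/
def omLinRels (n : ℕ) : Set ((Fin n × Fin n × Fin n × Fin n) →₀ ℤ) :=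
  {w | ∃ i j k l, w = Finsupp.single (i, j, k, l) 1 + Finsupp.single (j, i, k, l) 1} ∪
  {w | ∃ i j k l, w = Finsupp.single (i, j, k, l) 1 + Finsupp.single (i, k, j, l) 1} ∪
  {w | ∃ i j k l, w = Finsupp.single (i, j, k, l) 1 + Finsupp.single (i, j, l, k) 1} ∪
  {w | ∃ i j k l, ({i, j, k, l} : Finset (Fin n)).card ≠ 4 ∧
    w = Finsupp.single (i, j, k, l) 1} ∪
  {w | ∃ i j k l p, ({i, j, k, l, p} : Finset (Fin n)).card = 5 ∧
    w = Finsupp.single (i, j, k, l) 1 + Finsupp.single (j, k, l, p) 1 +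
        Finsupp.single (k, l, p, i) 1 + Finsupp.single (l, p, i, j) 1 +
        Finsupp.single (p, i, j, k) 1}

/-- The degree-1 component `Λ_n[1]`. -/
def OmModule (n : ℕ) :=
  ((Fin n × Fin n × Fin n × Fin n) →₀ ℤ) ⧸ Submodule.span ℤ (omLinRels n)

noncomputable instance (n : ℕ) : AddCommGroup (OmModule n) := by
  unfold OmModule; infer_instance
noncomputable instance (n : ℕ) : Module ℤ (OmModule n) := by
  unfold OmModule; infer_instance

/-- The coordinate-sum linear functional on `ℤⁿ`. -/
def coordSum (n : ℕ) : (Fin n → ℤ) →ₗ[ℤ] ℤ where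
  toFun v := ∑ i, v i
  map_add' := by intros; simp [Finset.sum_add_distrib]
  map_smul' := by intros; simp [Finset.mul_sum]

/-- The sublattice `𝔥_n ⊂ ℤⁿ` of vectors with coordinate sum `0`. -/
def hLattice (n : ℕ) : Submodule ℤ (Fin n → ℤ) := LinearMap.ker (coordSum n)

/-- The vector `e_i - e_l ∈ 𝔥_n`. -/
def hVec (n : ℕ) (i l : Fin n) : hLattice n :=
  ⟨Pi.single i 1 - Pi.single l 1, by
    simp [hLattice, LinearMap.mem_ker, coordSum, Finset.sum_sub_distrib]⟩

/-- The wedge `(e_i - e_l) ∧ (e_j - e_l) ∧ (e_k - e_l) ∈ ∧³𝔥_n`. -/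
noncomputable def tripleWedge (n : ℕ) (i j k l : Fin n) : ⋀[ℤ]^3 (hLattice n) :=
  ⟨ExteriorAlgebra.ιMulti ℤ 3 ![hVec n i l, hVec n j l, hVec n k l],
    ExteriorAlgebra.ιMulti_range ℤ 3 (Set.mem_range_self _)⟩

/-- A totally antisymmetric function of three indices. -/
structure AltThree {ι N : Type*} [AddCommGroup N] (F : ι → ι → ι → N) : Prop where
  swap12 : ∀ a b c, F b a c = - F a b c
  swap23 : ∀ a b c, F a c b = - F a b c
  diag12 : ∀ a c, F a a c = 0
  diag23 : ∀ a c, F c a a = 0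
  diag13 : ∀ a c, F a c a = 0

/-- The simplicial coboundary-type expression attached to `F`. -/
def dThree {ι N : Type*} [AddCommGroup N] (F : ι → ι → ι → N) (i j k l : ι) : N :=
  F i j k - F i j l - F i l k - F l j k

theorem AltThree.swap13 {ι N : Type*} [AddCommGroup N] {F : ι → ι → ι → N} (hF : AltThree F)
    (a b c : ι) : F c b a = - F a b c := by
  rw [hF.swap12 b c a, hF.swap23 b a c, hF.swap12 a b c]; simp

theorem AltThree.rot1 {ι N : Type*} [AddCommGroup N] {F : ι → ι → ι → N} (hF : AltThree F)
    (a b c : ι) : F b c a = F a b c := by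
  rw [hF.swap23 b a c, hF.swap12 a b c, neg_neg]

theorem AltThree.rot2 {ι N : Type*} [AddCommGroup N] {F : ι → ι → ι → N} (hF : AltThree F)
    (a b c : ι) : F c a b = F a b c := by
  rw [hF.swap12 a c b, hF.swap23 a b c, neg_neg]

/-- The trilinear extension of `F`. -/
def tri {ι N : Type*} [Fintype ι] [AddCommGroup N]
    (F : ι → ι → ι → N) (u v w : ι → ℤ) : N :=
  ∑ a, u a • ∑ b, v b • ∑ c, w c • F a b c

theorem tri_eq {ι N : Type*} [Fintype ι] [AddCommGroup N]
    (F : ι → ι → ι → N) (u v w : ι → ℤ) :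
    tri F u v w = ∑ p : ι × ι × ι, (u p.1 * (v p.2.1 * w p.2.2)) • F p.1 p.2.1 p.2.2 := by
  simp only [tri, Fintype.sum_prod_type, mul_smul, Finset.smul_sum]

theorem tri12 {ι N : Type*} [Fintype ι] [AddCommGroup N]
    {F : ι → ι → ι → N} (hF : AltThree F) (u w : ι → ℤ) : tri F u u w = 0 := by
  rw [tri_eq]
  refine Finset.sum_involution (fun p _ => (p.2.1, p.1, p.2.2)) ?_ ?_ ?_ ?_
  · rintro ⟨a, b, c⟩ -
    simp only [hF.swap12 a b c, smul_neg]
    rw [mul_left_comm (u b), add_neg_cancel]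
  · rintro ⟨a, b, c⟩ - hne heq
    simp only [Prod.mk.injEq] at heq
    obtain ⟨rfl, -⟩ := heq
    simp [hF.diag12] at hne
  · intros; exact Finset.mem_univ _
  · intros; rfl

theorem tri23 {ι N : Type*} [Fintype ι] [AddCommGroup N]
    {F : ι → ι → ι → N} (hF : AltThree F) (u w : ι → ℤ) : tri F w u u = 0 := by
  rw [tri_eq]
  refine Finset.sum_involution (fun p _ => (p.1, p.2.2, p.2.1)) ?_ ?_ ?_ ?_
  · rintro ⟨a, b, c⟩ -
    simp only [hF.swap23 a b c, smul_neg]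
    rw [mul_comm (u c), add_neg_cancel]
  · rintro ⟨a, b, c⟩ - hne heq
    simp only [Prod.mk.injEq] at heq
    obtain ⟨-, rfl, -⟩ := heq
    simp [hF.diag23] at hne
  · intros; exact Finset.mem_univ _
  · intros; rfl

theorem tri13 {ι N : Type*} [Fintype ι] [AddCommGroup N]
    {F : ι → ι → ι → N} (hF : AltThree F) (u w : ι → ℤ) : tri F u w u = 0 := by
  rw [tri_eq]
  refine Finset.sum_involution (fun p _ => (p.2.2, p.2.1, p.1)) ?_ ?_ ?_ ?_
  · rintro ⟨a, b, c⟩ -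
    simp only [hF.swap13 a b c, smul_neg]
    rw [show u c * (w b * u a) = u a * (w b * u c) by ring, add_neg_cancel]
  · rintro ⟨a, b, c⟩ - hne heq
    simp only [Prod.mk.injEq] at heq
    obtain ⟨rfl, -⟩ := heq
    simp [hF.diag13] at hne
  · intros; exact Finset.mem_univ _
  · intros; rfl

/-- Extension of an antisymmetric function to an alternating map on `ℤ^ι`. -/
noncomputable def triAlt {ι N : Type*} [Fintype ι] [AddCommGroup N]
    (F : ι → ι → ι → N) (hF : AltThree F) : (ι → ℤ) [⋀^Fin 3]→ₗ[ℤ] N :=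
  { MultilinearMap.mk' (R := ℤ) (M₁ := fun _ : Fin 3 => ι → ℤ)
      (fun v => tri F (v 0) (v 1) (v 2))
      (by
        intro m i x y
        fin_cases i <;> simp [tri, add_smul, smul_add, Finset.sum_add_distrib])
      (by
        intro m i r x
        fin_cases i <;> simp [tri, mul_smul, Finset.smul_sum, smul_comm r]) with
    map_eq_zero_of_eq' := by
      intro v i j hv hij
      change tri F (v 0) (v 1) (v 2) = 0
      have h : v 0 = v 1 ∨ v 1 = v 2 ∨ v 0 = v 2 := by
        fin_cases i <;> fin_cases j <;> simp_all
      rcases h with h | h | h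
      · rw [h]; exact tri12 hF _ _
      · rw [h]; exact tri23 hF _ _
      · rw [h]; exact tri13 hF _ _ }

theorem triAlt_apply {ι N : Type*} [Fintype ι] [AddCommGroup N]
    (F : ι → ι → ι → N) (hF : AltThree F) (v : Fin 3 → ι → ℤ) :
    triAlt F hF v = ∑ a, v 0 a • ∑ b, v 1 b • ∑ c, v 2 c • F a b c := rfl

theorem sum_single_sub {ι N : Type*} [Fintype ι] [DecidableEq ι] [AddCommGroup N]
    (X : ι → N) (i l : ι) :
    ∑ a, (Pi.single i (1 : ℤ) - Pi.single l (1 : ℤ) : ι → ℤ) a • X a = X i - X l := by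
  simp [sub_smul, Finset.sum_sub_distrib, Pi.single_apply, ite_smul]

/-- A linear map out of the free module given by `dThree F` kills the relations. -/
theorem dThree_kills {n : ℕ} {N : Type*} [AddCommGroup N] (F : Fin n → Fin n → Fin n → N)
    (hF : AltThree F) :
    Submodule.span ℤ (omLinRels n) ≤ LinearMap.ker
      (Finsupp.linearCombination ℤ
        (fun p : Fin n × Fin n × Fin n × Fin n => dThree F p.1 p.2.1 p.2.2.1 p.2.2.2)) := by
  rw [Submodule.span_le]
  rintro w ((((⟨i, j, k, l, rfl⟩ | ⟨i, j, k, l, rfl⟩) | ⟨i, j, k, l, rfl⟩) |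
    ⟨i, j, k, l, h, rfl⟩) | ⟨i, j, k, l, p, h, rfl⟩)
  · simp only [SetLike.mem_coe, LinearMap.mem_ker, map_add, Finsupp.linearCombination_single,
      one_smul, dThree]
    rw [hF.swap12 i j k, hF.swap12 i j l, hF.swap12 l j k, hF.swap12 i l k]
    abel
  · simp only [SetLike.mem_coe, LinearMap.mem_ker, map_add, Finsupp.linearCombination_single,
      one_smul, dThree]
    rw [hF.swap23 i j k, hF.swap23 i l k, hF.swap23 i j l, hF.swap23 l j k]
    abel
  · simp only [SetLike.mem_coe, LinearMap.mem_ker, map_add, Finsupp.linearCombination_single,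
      one_smul, dThree]
    rw [hF.swap23 i l k, hF.swap13 l j k]
    abel
  · simp only [SetLike.mem_coe, LinearMap.mem_ker, Finsupp.linearCombination_single,
      one_smul, dThree]
    have hc : i = j ∨ i = k ∨ i = l ∨ j = k ∨ j = l ∨ k = l := by
      by_contra hcon
      push Not at hcon
      apply h
      rw [Finset.card_insert_of_notMem, Finset.card_insert_of_notMem,
        Finset.card_insert_of_notMem, Finset.card_singleton] <;> simp <;> tauto
    rcases hc with rfl | rfl | rfl | rfl | rfl | rfl
    · rw [hF.swap12 i l k]; simp [hF.diag12]
    · rw [hF.swap13 i j l]; simp [hF.diag13]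
    · simp [hF.diag12, hF.diag13]
    · rw [hF.swap23 i l j]; simp [hF.diag23]
    · simp [hF.diag12, hF.diag23]
    · simp [hF.diag13, hF.diag23]
  · simp only [SetLike.mem_coe, LinearMap.mem_ker, map_add, Finsupp.linearCombination_single,
      one_smul, dThree]
    rw [hF.swap23 i k l, hF.rot2 j k l, hF.swap23 j l p, hF.rot2 k l p, hF.rot1 i k l,
      hF.swap12 i k p, hF.rot1 i l p, hF.rot1 j l p, hF.swap13 i j l, hF.rot1 i j p,
      hF.rot2 i j p, hF.rot2 i k p, hF.swap13 j k p, hF.rot2 i j k]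
    abel

/-- The class of `ω_{ijkl}`. -/
noncomputable def omCls (n : ℕ) (i j k l : Fin n) : OmModule n :=
  Submodule.Quotient.mk (Finsupp.single (i, j, k, l) 1)

theorem omCls_swap12 (n : ℕ) (i j k l : Fin n) : omCls n j i k l = - omCls n i j k l := by
  rw [eq_neg_iff_add_eq_zero, add_comm]
  exact (Submodule.Quotient.mk_eq_zero _).2 (Submodule.subset_span
    (Or.inl (Or.inl (Or.inl (Or.inl ⟨i, j, k, l, rfl⟩)))))

theorem omCls_swap23 (n : ℕ) (i j k l : Fin n) : omCls n i k j l = - omCls n i j k l := by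
  rw [eq_neg_iff_add_eq_zero, add_comm]
  exact (Submodule.Quotient.mk_eq_zero _).2 (Submodule.subset_span
    (Or.inl (Or.inl (Or.inl (Or.inr ⟨i, j, k, l, rfl⟩)))))

theorem omCls_swap34 (n : ℕ) (i j k l : Fin n) : omCls n i j l k = - omCls n i j k l := by
  rw [eq_neg_iff_add_eq_zero, add_comm]
  exact (Submodule.Quotient.mk_eq_zero _).2 (Submodule.subset_span
    (Or.inl (Or.inl (Or.inr ⟨i, j, k, l, rfl⟩))))

theorem omCls_zero (n : ℕ) (i j k l : Fin n)
    (h : ({i, j, k, l} : Finset (Fin n)).card ≠ 4) : omCls n i j k l = 0 :=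
  (Submodule.Quotient.mk_eq_zero _).2 (Submodule.subset_span
    (Or.inl (Or.inr ⟨i, j, k, l, h, rfl⟩)))

theorem omCls_five (n : ℕ) (i j k l p : Fin n)
    (h : ({i, j, k, l, p} : Finset (Fin n)).card = 5) :
    omCls n i j k l + omCls n j k l p + omCls n k l p i + omCls n l p i j + omCls n p i j k = 0 :=
  (Submodule.Quotient.mk_eq_zero _).2 (Submodule.subset_span
    (Or.inr ⟨i, j, k, l, p, h, rfl⟩))

theorem omCls_diag12 (n : ℕ) (a c d : Fin n) : omCls n a a c d = 0 := by
  apply omCls_zero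
  have := Finset.card_le_three (a := a) (b := c) (c := d)
  simp only [Finset.insert_idem]
  omega

theorem omCls_diag23 (n : ℕ) (a c d : Fin n) : omCls n c a a d = 0 := by
  apply omCls_zero
  have := Finset.card_le_three (a := c) (b := a) (c := d)
  simp only [Finset.insert_idem]
  omega

theorem omCls_diag34 (n : ℕ) (a c d : Fin n) : omCls n c d a a = 0 := by
  apply omCls_zero
  have := Finset.card_le_three (a := c) (b := d) (c := a)
  simp only [Finset.pair_eq_singleton]
  omega

theorem omCls_diag13 (n : ℕ) (a c d : Fin n) : omCls n a c a d = 0 := by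
  rw [omCls_swap23, omCls_diag12, neg_zero]

theorem omCls_diag24 (n : ℕ) (a c d : Fin n) : omCls n d a c a = 0 := by
  rw [omCls_swap23, omCls_diag34, neg_zero]

theorem omCls_diag14 (n : ℕ) (a c d : Fin n) : omCls n a c d a = 0 := by
  rw [omCls_swap34, omCls_diag13, neg_zero]

theorem omCls_alt (n : ℕ) (z : Fin n) : AltThree (fun a b c => omCls n a b c z) where
  swap12 a b c := omCls_swap12 n a b c z
  swap23 a b c := omCls_swap23 n a b c z
  diag12 a c := omCls_diag12 n a c z
  diag23 a c := omCls_diag23 n a c z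
  diag13 a c := omCls_diag13 n a c z

theorem dThree_omCls (n : ℕ) (z i j k l : Fin n) :
    dThree (fun a b c => omCls n a b c z) i j k l = omCls n i j k l := by
  simp only [dThree]
  by_cases h : i = j ∨ i = k ∨ i = l ∨ j = k ∨ j = l ∨ k = l ∨ i = z ∨ j = z ∨ k = z ∨ l = z
  · rcases h with rfl | rfl | rfl | rfl | rfl | rfl | rfl | rfl | rfl | rfl
    · rw [omCls_swap12 n i l k z]; simp [omCls_diag12]
    · rw [(omCls_alt n z).swap13 i j l]; simp [omCls_diag13]
    · simp [omCls_diag12, omCls_diag13, omCls_diag14]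
    · rw [omCls_swap23 n i l j z]; simp [omCls_diag23]
    · simp [omCls_diag12, omCls_diag23, omCls_diag24]
    · simp [omCls_diag13, omCls_diag23, omCls_diag34]
    · simp only [omCls_diag14]
      rw [omCls_swap34 n l j i k, omCls_swap23 n l i j k, omCls_swap12 n i l j k,
        omCls_swap34 n i l k j, omCls_swap23 n i k l j, omCls_swap34 n i k j l,
        omCls_swap23 n i j k l]
      simp
    · simp only [omCls_diag24]
      rw [omCls_swap34 n i l j k, omCls_swap23 n i j l k, omCls_swap34 n i j k l]
      simp
    · simp only [omCls_diag34]
      rw [omCls_swap34 n i j k l]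
      simp
    · simp [omCls_diag34, omCls_diag24, omCls_diag14]
  · have h5 : ({i, j, k, l, z} : Finset (Fin n)).card = 5 := by
      push Not at h
      rw [Finset.card_insert_of_notMem, Finset.card_insert_of_notMem,
        Finset.card_insert_of_notMem, Finset.card_insert_of_notMem,
        Finset.card_singleton] <;> simp <;> tauto
    have e := omCls_five n i j k l z h5
    have e1 : omCls n k l z i = - omCls n i k l z := by
      rw [omCls_swap34 n k l i z, (omCls_alt n z).rot1 i k l]
    have e2 : omCls n l z i j = omCls n i j l z := by
      rw [omCls_swap23 n l i z j, omCls_swap34 n l i j z, (omCls_alt n z).rot2 i j l, neg_neg]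
    have e3 : omCls n z i j k = - omCls n i j k z := by
      rw [omCls_swap12 n i z j k, omCls_swap23 n i j z k, omCls_swap34 n i j k z]; simp
    rw [e1, e2, e3] at e
    rw [omCls_swap23 n i k l z, (omCls_alt n z).rot2 j k l, ← sub_eq_zero, ← neg_eq_zero, ← e]
    abel

/-- The wedge of three elements of `𝔥_n`. -/
noncomputable def wThree (n : ℕ) (x y z : hLattice n) : ⋀[ℤ]^3 (hLattice n) :=
  (((exteriorPower.ιMulti ℤ 3 (M := hLattice n)).curryLeft x).curryLeft y).curryLeft z ![]

theorem wThree_eq (n : ℕ) (x y z : hLattice n) :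
    wThree n x y z = exteriorPower.ιMulti ℤ 3 ![x, y, z] := rfl

theorem tripleWedge_eq (n : ℕ) (i j k l : Fin n) :
    tripleWedge n i j k l = wThree n (hVec n i l) (hVec n j l) (hVec n k l) := rfl

theorem wThree_sum1 {n : ℕ} {ι : Type*} [Fintype ι] (u : ι → ℤ) (e : ι → hLattice n)
    (y z : hLattice n) :
    wThree n (∑ a, u a • e a) y z = ∑ a, u a • wThree n (e a) y z := by
  have h : ∀ x, wThree n x y z =
      (exteriorPower.ιMulti ℤ 3 (M := hLattice n)).toMultilinearMap.toLinearMap ![0, y, z] 0 x := by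
    intro x
    rw [wThree_eq]
    change _ = exteriorPower.ιMulti ℤ 3 (Function.update ![0, y, z] 0 x)
    congr 1; ext1 i; fin_cases i <;> rfl
  simp only [h, map_sum, map_zsmul]

theorem wThree_sum2 {n : ℕ} {ι : Type*} [Fintype ι] (u : ι → ℤ) (e : ι → hLattice n)
    (y z : hLattice n) :
    wThree n y (∑ a, u a • e a) z = ∑ a, u a • wThree n y (e a) z := by
  have h : ∀ x, wThree n y x z =
      (exteriorPower.ιMulti ℤ 3 (M := hLattice n)).toMultilinearMap.toLinearMap ![y, 0, z] 1 x := by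
    intro x
    rw [wThree_eq]
    change _ = exteriorPower.ιMulti ℤ 3 (Function.update ![y, 0, z] 1 x)
    congr 1; ext1 i; fin_cases i <;> rfl
  simp only [h, map_sum, map_zsmul]

theorem wThree_sum3 {n : ℕ} {ι : Type*} [Fintype ι] (u : ι → ℤ) (e : ι → hLattice n)
    (y z : hLattice n) :
    wThree n y z (∑ a, u a • e a) = ∑ a, u a • wThree n y z (e a) := by
  have h : ∀ x, wThree n y z x =
      (exteriorPower.ιMulti ℤ 3 (M := hLattice n)).toMultilinearMap.toLinearMap ![y, z, 0] 2 x := by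
    intro x
    rw [wThree_eq]
    change _ = exteriorPower.ιMulti ℤ 3 (Function.update ![y, z, 0] 2 x)
    congr 1; ext1 i; fin_cases i <;> rfl
  simp only [h, map_sum, map_zsmul]

theorem wThree_alt (n : ℕ) (e : Fin n → hLattice n) :
    AltThree (fun a b c => wThree n (e a) (e b) (e c)) where
  swap12 a b c := by
    have := (exteriorPower.ιMulti ℤ 3 (M := hLattice n)).map_swap ![e a, e b, e c]
      (i := 0) (j := 1) (by decide)
    rw [wThree_eq, wThree_eq, ← this]
    congr 1; ext1 i; fin_cases i <;> rfl
  swap23 a b c := by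
    have := (exteriorPower.ιMulti ℤ 3 (M := hLattice n)).map_swap ![e a, e b, e c]
      (i := 1) (j := 2) (by decide)
    rw [wThree_eq, wThree_eq, ← this]
    congr 1; ext1 i; fin_cases i <;> rfl
  diag12 a c := AlternatingMap.map_eq_zero_of_eq
    (exteriorPower.ιMulti ℤ 3 (M := hLattice n)) ![e a, e a, e c] (i := 0) (j := 1) rfl (by decide)
  diag23 a c := AlternatingMap.map_eq_zero_of_eq
    (exteriorPower.ιMulti ℤ 3 (M := hLattice n)) ![e c, e a, e a] (i := 1) (j := 2) rfl (by decide)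
  diag13 a c := AlternatingMap.map_eq_zero_of_eq
    (exteriorPower.ιMulti ℤ 3 (M := hLattice n)) ![e a, e c, e a] (i := 0) (j := 2) rfl (by decide)

theorem hVec_eq_sum (n : ℕ) (z i l : Fin n) :
    hVec n i l =
      ∑ a, (Pi.single i (1 : ℤ) - Pi.single l (1 : ℤ) : Fin n → ℤ) a • hVec n a z := by
  rw [sum_single_sub]
  apply Subtype.ext
  simp [hVec]

theorem hLattice_eq_sum (n : ℕ) (z : Fin n) (v : hLattice n) :
    v = ∑ a, (v : Fin n → ℤ) a • hVec n a z := by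
  have hv : ∑ a, (v : Fin n → ℤ) a = 0 := v.2
  apply Subtype.ext
  simp only [hVec, Submodule.coe_sum, Submodule.coe_smul]
  simp only [smul_sub, Finset.sum_sub_distrib, ← Finset.sum_smul, hv, zero_smul, sub_zero]
  ext b
  simp [Pi.single_apply, Finset.sum_apply]

theorem tripleWedge_dThree (n : ℕ) (z i j k l : Fin n) :
    tripleWedge n i j k l =
      dThree (fun a b c => wThree n (hVec n a z) (hVec n b z) (hVec n c z)) i j k l := by
  have hW := wThree_alt n (fun a => hVec n a z)
  rw [tripleWedge_eq, hVec_eq_sum n z i l, hVec_eq_sum n z j l, hVec_eq_sum n z k l]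
  simp only [wThree_sum1]
  simp only [wThree_sum2]
  simp only [wThree_sum3]
  simp only [sum_single_sub]
  have h1 := hW.diag12 l k
  have h2 := hW.diag23 l i
  have h3 := hW.diag13 l j
  have h4 := hW.diag12 l l
  simp only [dThree] at *
  rw [h1, h2, h3, h4]
  abel

theorem finrank_hLattice (n : ℕ) : Module.finrank ℤ (hLattice n) = n - 1 := by
  have h := Submodule.finrank_quotient_add_finrank (LinearMap.ker (coordSum n))
  rw [(coordSum n).quotKerEquivRange.finrank_eq, Module.finrank_fin_fun] at h
  change _ + Module.finrank ℤ (hLattice n) = n at h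
  rcases n with _ | m
  · omega
  · have hr : LinearMap.range (coordSum (m + 1)) = ⊤ := by
      rw [LinearMap.range_eq_top]
      intro c
      exact ⟨Pi.single 0 c, by simp [coordSum]⟩
    rw [hr, finrank_top, Module.finrank_self] at h
    omega

theorem finrank_wedge (n : ℕ) :
    Module.finrank ℤ (⋀[ℤ]^3 (hLattice n)) = (n - 1) * (n - 2) * (n - 3) / 6 := by
  rw [exteriorPower.finrank_eq, finrank_hLattice, Nat.choose_eq_descFactorial_div_factorial]
  simp only [Nat.descFactorial, Nat.factorial]
  congr 1
  rw [show n - 1 - 2 = n - 3 by omega, show n - 1 - 1 = n - 2 by omega,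
    Nat.sub_zero]
  ring

/-- The forward map. -/
noncomputable def omFwd (n : ℕ) (z : Fin n) : OmModule n →ₗ[ℤ] ⋀[ℤ]^3 (hLattice n) :=
  (Submodule.span ℤ (omLinRels n)).liftQ _
    (dThree_kills _ (wThree_alt n (fun a => hVec n a z)))

theorem omFwd_cls (n : ℕ) (z i j k l : Fin n) :
    omFwd n z (omCls n i j k l) = tripleWedge n i j k l := by
  rw [tripleWedge_dThree n z]
  refine (Submodule.liftQ_apply _ _ _).trans ?_
  simp

/-- The inverse map. -/
noncomputable def omBwd (n : ℕ) (z : Fin n) : ⋀[ℤ]^3 (hLattice n) →ₗ[ℤ] OmModule n :=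
  exteriorPower.alternatingMapLinearEquiv
    ((triAlt _ (omCls_alt n z)).compLinearMap (hLattice n).subtype)

theorem omBwd_wThree (n : ℕ) (z : Fin n) (u v w : hLattice n) :
    omBwd n z (wThree n u v w) = tri (fun a b c => omCls n a b c z) u v w := by
  rw [wThree_eq]
  exact exteriorPower.alternatingMapLinearEquiv_apply_ιMulti _ _

theorem omBwd_tripleWedge (n : ℕ) (z i j k l : Fin n) :
    omBwd n z (tripleWedge n i j k l) = omCls n i j k l := by
  rw [tripleWedge_eq, omBwd_wThree, ← dThree_omCls n z]
  simp only [tri, hVec, sum_single_sub, dThree, omCls_diag12, omCls_diag13, omCls_diag23]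
  abel

theorem om_ext {n : ℕ} {N : Type*} [AddCommGroup N] [Module ℤ N] (f g : OmModule n →ₗ[ℤ] N)
    (h : ∀ i j k l, f (omCls n i j k l) = g (omCls n i j k l)) : f = g := by
  refine Submodule.linearMap_qext _ ?_
  refine Finsupp.lhom_ext' ?_
  rintro ⟨i, j, k, l⟩
  refine LinearMap.ext_ring ?_
  exact h i j k l

/-- The isomorphism. -/
noncomputable def omEquiv (n : ℕ) (z : Fin n) : OmModule n ≃ₗ[ℤ] ⋀[ℤ]^3 (hLattice n) :=
  LinearEquiv.ofLinearMap (omFwd n z) (omBwd n z)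
    (by
      apply exteriorPower.linearMap_ext
      ext1 v
      have hv : exteriorPower.ιMulti ℤ 3 v = wThree n (v 0) (v 1) (v 2) := by
        rw [wThree_eq]; congr 1; ext1 i; fin_cases i <;> rfl
      simp only [LinearMap.compAlternatingMap_apply, LinearMap.comp_apply, LinearMap.id_apply, hv,
        omBwd_wThree]
      conv_rhs => rw [hLattice_eq_sum n z (v 0), hLattice_eq_sum n z (v 1),
        hLattice_eq_sum n z (v 2)]
      simp only [wThree_sum1]
      simp only [wThree_sum2]
      simp only [wThree_sum3]
      simp only [tri, map_sum, map_zsmul, omFwd_cls, tripleWedge_eq])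
    (by
      apply om_ext
      intro i j k l
      simp only [LinearMap.comp_apply, LinearMap.id_apply, omFwd_cls, omBwd_tripleWedge])

theorem om_exists (n : ℕ) : ∃ f : OmModule n ≃ₗ[ℤ] ⋀[ℤ]^3 (hLattice n),
      ∀ i j k l : Fin n, f (omCls n i j k l) = tripleWedge n i j k l := by
  rcases n with _ | m
  · have h1 : ∀ x : OmModule 0, x = 0 := fun x => by
      have := om_ext (n := 0) LinearMap.id 0 (fun i => i.elim0)
      exact LinearMap.congr_fun this x
    have h2 : ∀ y : ⋀[ℤ]^3 (hLattice 0), y = 0 := fun y => by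
      have : Subsingleton (⋀[ℤ]^3 (hLattice 0)) := by
        rw [← Module.finrank_eq_zero_iff_of_free (R := ℤ), finrank_wedge]
      exact Subsingleton.elim _ _
    exact ⟨LinearEquiv.ofLinearMap 0 0 (LinearMap.ext fun y => by rw [h2 y]; simp)
      (LinearMap.ext fun x => by rw [h1 x]; simp), fun i => i.elim0⟩
  · exact ⟨omEquiv (m + 1) 0, fun i j k l => omFwd_cls _ _ i j k l⟩

/-- The degree-1 component of `Λ_n` is a free `ℤ`-module of rank `(n-1)(n-2)(n-3)/6`,
isomorphic to `∧³𝔥_n` via `ω_{ijkl} ↦ (e_i - e_l) ∧ (e_j - e_l) ∧ (e_k - e_l)`. -/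
theorem lambda_degree_one (n : ℕ) :
    (∃ f : OmModule n ≃ₗ[ℤ] ⋀[ℤ]^3 (hLattice n),
      ∀ i j k l : Fin n,
        f (Submodule.Quotient.mk (Finsupp.single (i, j, k, l) 1)) = tripleWedge n i j k l) ∧
    Module.Free ℤ (OmModule n) ∧
    Module.finrank ℤ (OmModule n) = (n - 1) * (n - 2) * (n - 3) / 6 := by
  obtain ⟨f, hf⟩ := om_exists n
  exact ⟨⟨f, hf⟩, Module.Free.of_equiv f.symm, f.finrank_eq.trans (finrank_wedge n)⟩
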